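/- arXiv:2406.07807 — 2 statements merged into one kernel-verified Lean document; each statement's English description precedes it below -/
import Mathlib

section
/- Let ρ ≥ 0 be a real number. For every real γ ≥ 0, one has ln(1+γ) − γ + (1+γ)·ρ/(1+ρ) ≤ ln(1+ρ), with equality if and only if γ = ρ. Consequently ln(1+ρ) = max over γ ≥ 0 of [ln(1+γ) − γ + (1+γ)·ρ/(1+ρ)], and the maximum is attained uniquely at γ = ρ. -/
/-- The gap in the Lagrangian dual transform, in terms of the ratio `(1 + γ) / (1 + ρ)`. -/
lemma lagrangian_dual_eq_add_log_sub {ρ γ : ℝ} (hρ : 0 < 1 + ρ) (hγ : 0 < 1 + γ) :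
    Real.log (1 + γ) - γ + (1 + γ) * ρ / (1 + ρ) =
      Real.log (1 + ρ) +
        (Real.log ((1 + γ) / (1 + ρ)) - ((1 + γ) / (1 + ρ) - 1)) := by
  rw [Real.log_div hγ.ne' hρ.ne']
  field_simp
  ring

lemma lagrangian_dual_self {ρ : ℝ} (hρ : 0 < 1 + ρ) :
    Real.log (1 + ρ) - ρ + (1 + ρ) * ρ / (1 + ρ) = Real.log (1 + ρ) := by
  rw [mul_div_cancel_left₀ _ hρ.ne', sub_add_cancel]

lemma lagrangian_dual_lt {ρ γ : ℝ} (hρ : 0 < 1 + ρ) (hγ : 0 < 1 + γ) (hne : γ ≠ ρ) :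
    Real.log (1 + γ) - γ + (1 + γ) * ρ / (1 + ρ) < Real.log (1 + ρ) := by
  have hratio : (1 + γ) / (1 + ρ) ≠ 1 := by
    rw [Ne, div_eq_one_iff_eq hρ.ne']
    exact fun h => hne (add_left_cancel h)
  rw [lagrangian_dual_eq_add_log_sub hρ hγ]
  linarith [Real.log_lt_sub_one_of_pos (div_pos hγ hρ) hratio]

/-- Lagrangian dual transform: for `ρ ≥ 0`, for all `γ ≥ 0`,
`ln(1+γ) - γ + (1+γ)ρ/(1+ρ) ≤ ln(1+ρ)`, with equality iff `γ = ρ`; hence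
`ln(1+ρ)` is the maximum over `γ ≥ 0`, attained (uniquely) at `γ = ρ`. -/
theorem lagrangian_dual_transform (ρ : ℝ) (hρ : 0 ≤ ρ) :
    (∀ γ : ℝ, 0 ≤ γ →
        Real.log (1 + γ) - γ + (1 + γ) * ρ / (1 + ρ) ≤ Real.log (1 + ρ)) ∧
      (∀ γ : ℝ, 0 ≤ γ →
        (Real.log (1 + γ) - γ + (1 + γ) * ρ / (1 + ρ) = Real.log (1 + ρ) ↔ γ = ρ)) ∧
      IsGreatest
        ((fun γ => Real.log (1 + γ) - γ + (1 + γ) * ρ / (1 + ρ)) '' Set.Ici 0)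
        (Real.log (1 + ρ)) := by
  have hρ' : 0 < 1 + ρ := by linarith
  have hle : ∀ γ : ℝ, 0 ≤ γ →
      Real.log (1 + γ) - γ + (1 + γ) * ρ / (1 + ρ) ≤ Real.log (1 + ρ) := by
    intro γ hγ
    rcases eq_or_ne γ ρ with rfl | hne
    · exact (lagrangian_dual_self hρ').le
    · exact (lagrangian_dual_lt hρ' (by linarith) hne).le
  refine ⟨hle, fun γ hγ => ⟨fun h => ?_, ?_⟩, ⟨ρ, hρ, lagrangian_dual_self hρ'⟩, ?_⟩
  · by_contra hne
    exact (lagrangian_dual_lt hρ' (by linarith) hne).ne h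
  · rintro rfl
    exact lagrangian_dual_self hρ'
  · rintro _ ⟨γ, hγ, rfl⟩
    exact hle γ hγ
end

section
/- Let a ∈ ℂ and let B > 0 be a real number. For all real γ ≥ 0 and all ν ∈ ℂ, one has ln(1+γ) − γ + 2·√(1+γ)·Re{ν̄·a} − |ν|²·(|a|² + B) ≤ ln(1 + |a|²/B), with equality when γ = |a|²/B and ν = √(1+γ)·a/(|a|² + B). Hence the joint maximum over (γ, ν) ∈ [0,∞) × ℂ of the left-hand side equals ln(1 + |a|²/B). -/
/-- Quadratic transform bound, by completing the square. -/
lemma two_mul_re_conj_mul_sub_le (a ν : ℂ) (s : ℝ) {S : ℝ} (hs : 0 ≤ s) (hS : 0 < S) :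
    2 * s * ((starRingEnd ℂ) ν * a).re - ‖ν‖ ^ 2 * S ≤ s ^ 2 * ‖a‖ ^ 2 / S := by
  have hre : ((starRingEnd ℂ) ν * a).re ≤ ‖ν‖ * ‖a‖ := by
    simpa using Complex.re_le_norm ((starRingEnd ℂ) ν * a)
  have hmul : 2 * s * ((starRingEnd ℂ) ν * a).re ≤ 2 * s * (‖ν‖ * ‖a‖) := by gcongr
  have hsq : s ^ 2 * ‖a‖ ^ 2 / S - (2 * s * (‖ν‖ * ‖a‖) - ‖ν‖ ^ 2 * S)
      = (s * ‖a‖ - ‖ν‖ * S) ^ 2 / S := by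
    field_simp
    ring
  have hnonneg : 0 ≤ (s * ‖a‖ - ‖ν‖ * S) ^ 2 / S := by positivity
  linarith

/-- The quadratic transform bound is attained at `ν = s a / S`. -/
lemma two_mul_re_conj_mul_sub_eq (a : ℂ) (s : ℝ) {S : ℝ} (hS : S ≠ 0) :
    2 * s * ((starRingEnd ℂ) ((s : ℂ) * a / (S : ℂ)) * a).re -
      ‖(s : ℂ) * a / (S : ℂ)‖ ^ 2 * S = s ^ 2 * ‖a‖ ^ 2 / S := by
  have hre : ((starRingEnd ℂ) ((s : ℂ) * a / (S : ℂ)) * a).re = s * ‖a‖ ^ 2 / S := by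
    have h : (starRingEnd ℂ) ((s : ℂ) * a / (S : ℂ)) * a
        = ((s * ‖a‖ ^ 2 / S : ℝ) : ℂ) := by
      simp only [map_div₀, map_mul, Complex.conj_ofReal]
      push_cast
      rw [← Complex.conj_mul']
      ring
    rw [h, Complex.ofReal_re]
  rw [hre, norm_div, norm_mul, Complex.norm_real, Complex.norm_real, div_pow, mul_pow,
    Real.norm_eq_abs, Real.norm_eq_abs, sq_abs, sq_abs]
  field_simp
  ring

/-- Lagrangian dual transform bound, from `log x ≤ x - 1`. -/
lemma log_sub_add_le_log_one_add_div {t B γ : ℝ} (ht : 0 ≤ t) (hB : 0 < B) (hγ : 0 ≤ γ) :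
    Real.log (1 + γ) - γ + (1 + γ) * t / (t + B) ≤ Real.log (1 + t / B) := by
  have hx : 0 < (1 + γ) * B / (t + B) := by positivity
  have hlog := Real.log_le_sub_one_of_pos hx
  have hprod : 1 + γ = (1 + γ) * B / (t + B) * (1 + t / B) := by
    field_simp
    ring
  have hsplit : Real.log (1 + γ)
      = Real.log ((1 + γ) * B / (t + B)) + Real.log (1 + t / B) := by
    rw [← Real.log_mul hx.ne' (by positivity), ← hprod]
  have hsum : (1 + γ) * t / (t + B) = 1 + γ - (1 + γ) * B / (t + B) := by
    field_simp
    ring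
  linarith

/-- Combined Lagrangian-dual + quadratic transform: for `a ∈ ℂ`, `B > 0`, all `γ ≥ 0`
and `ν ∈ ℂ`,
`ln(1+γ) - γ + 2√(1+γ) Re{ν̄ a} - |ν|²(|a|²+B) ≤ ln(1 + |a|²/B)`,
with equality at `γ = |a|²/B`, `ν = √(1+γ) a/(|a|²+B)`; hence the joint maximum
over `(γ, ν) ∈ [0,∞) × ℂ` equals `ln(1 + |a|²/B)`. -/
theorem combined_fp_transform (a : ℂ) (B : ℝ) (hB : 0 < B) :
    (∀ γ : ℝ, 0 ≤ γ → ∀ ν : ℂ,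
        Real.log (1 + γ) - γ + 2 * Real.sqrt (1 + γ) * ((starRingEnd ℂ) ν * a).re -
            ‖ν‖ ^ 2 * (‖a‖ ^ 2 + B) ≤ Real.log (1 + ‖a‖ ^ 2 / B)) ∧
      (let γ₀ : ℝ := ‖a‖ ^ 2 / B
       let ν₀ : ℂ := (Real.sqrt (1 + γ₀) : ℂ) * a / ((‖a‖ ^ 2 + B : ℝ) : ℂ)
       Real.log (1 + γ₀) - γ₀ + 2 * Real.sqrt (1 + γ₀) * ((starRingEnd ℂ) ν₀ * a).re -
          ‖ν₀‖ ^ 2 * (‖a‖ ^ 2 + B) = Real.log (1 + ‖a‖ ^ 2 / B)) ∧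
      IsGreatest
        ((fun p : ℝ × ℂ =>
            Real.log (1 + p.1) - p.1 +
              2 * Real.sqrt (1 + p.1) * ((starRingEnd ℂ) p.2 * a).re -
                ‖p.2‖ ^ 2 * (‖a‖ ^ 2 + B)) '' (Set.Ici 0 ×ˢ Set.univ))
        (Real.log (1 + ‖a‖ ^ 2 / B)) := by
  have hS : 0 < ‖a‖ ^ 2 + B := by positivity
  have hle : ∀ γ : ℝ, 0 ≤ γ → ∀ ν : ℂ,
      Real.log (1 + γ) - γ + 2 * Real.sqrt (1 + γ) * ((starRingEnd ℂ) ν * a).re -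
          ‖ν‖ ^ 2 * (‖a‖ ^ 2 + B) ≤ Real.log (1 + ‖a‖ ^ 2 / B) := by
    intro γ hγ ν
    have hquad := two_mul_re_conj_mul_sub_le a ν _ (Real.sqrt_nonneg (1 + γ)) hS
    rw [Real.sq_sqrt (by positivity)] at hquad
    have hdual := log_sub_add_le_log_one_add_div (sq_nonneg ‖a‖) hB hγ
    linarith
  have heq : let γ₀ : ℝ := ‖a‖ ^ 2 / B
      let ν₀ : ℂ := (Real.sqrt (1 + γ₀) : ℂ) * a / ((‖a‖ ^ 2 + B : ℝ) : ℂ)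
      Real.log (1 + γ₀) - γ₀ + 2 * Real.sqrt (1 + γ₀) * ((starRingEnd ℂ) ν₀ * a).re -
        ‖ν₀‖ ^ 2 * (‖a‖ ^ 2 + B) = Real.log (1 + ‖a‖ ^ 2 / B) := by
    intro γ₀ ν₀
    have hquad := two_mul_re_conj_mul_sub_eq a (Real.sqrt (1 + γ₀)) hS.ne'
    have hγ₀ : (1 + γ₀) * ‖a‖ ^ 2 / (‖a‖ ^ 2 + B) = γ₀ := by
      simp only [γ₀]
      field_simp
      ring
    rw [Real.sq_sqrt (by positivity), hγ₀] at hquad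
    linarith
  refine ⟨hle, heq, ⟨(_, _), ⟨?_, Set.mem_univ _⟩, heq⟩, ?_⟩
  · exact Set.mem_Ici.2 (by positivity)
  · rintro _ ⟨⟨γ, ν⟩, ⟨hγ, -⟩, rfl⟩
    exact hle γ hγ ν
end
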